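/- Let G = (V,E) be a finite connected simple graph with n = |V| vertices. Then the number σ(G) of successive vertex orderings of G satisfies σ(G) = n! · P_G(−1), where P_G is the successive ordering polynomial of G. Equivalently, P_G(−1) equals the probability that a uniformly random linear ordering of V is successive. -/

import Mathlib

open Finset Polynomial

variable {V : Type*} [Fintype V] [DecidableEq V]

/-- The closed neighbourhood `N[I]` of a set of vertices `I`. -/
def closedNbhd (G : SimpleGraph V) [DecidableRel G.Adj] (I : Finset V) : Finset V :=
  I ∪ I.biUnion fun v => G.neighborFinset v

/-- `a(I) = |V \ N[I]| = n - |N[I]|`. -/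
def aPar (G : SimpleGraph V) [DecidableRel G.Adj] (I : Finset V) : ℕ :=
  Fintype.card V - (closedNbhd G I).card

/-- `I` is an independent set: no two of its vertices are adjacent. -/
def IsIndep (G : SimpleGraph V) (I : Finset V) : Prop :=
  ∀ u ∈ I, ∀ v ∈ I, ¬ G.Adj u v

instance (G : SimpleGraph V) [DecidableRel G.Adj] : DecidablePred (IsIndep G) :=
  fun I => inferInstanceAs (Decidable (∀ u ∈ I, ∀ v ∈ I, ¬ G.Adj u v))

/-- For a list `ρ = (ρ₁, …, ρ_k)`, the product `∏_{j=1}^k 1/(n - a({ρ_j, …, ρ_k}))`. -/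
def prodTerm (G : SimpleGraph V) [DecidableRel G.Adj] : List V → ℚ
  | [] => 1
  | v :: l =>
      (1 / ((Fintype.card V : ℚ) - (aPar G (v :: l).toFinset : ℚ))) * prodTerm G l

/-- `b(I)`: the sum over all permutations `ρ` of `I` of
`∏_{j=1}^k 1/(n - a({ρ_j, …, ρ_k}))`; in particular `b(∅) = 1`. -/
noncomputable def bPar (G : SimpleGraph V) [DecidableRel G.Adj] (I : Finset V) : ℚ :=
  (I.toList.permutations.map (prodTerm G)).sum

/-- A linear ordering `π : V ≃ Fin n` is successive if every vertex which is not first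
has a neighbour appearing earlier. -/
def IsSuccessive (G : SimpleGraph V) (π : V ≃ Fin (Fintype.card V)) : Prop :=
  ∀ v : V, (π v : ℕ) ≠ 0 → ∃ u : V, G.Adj u v ∧ π u < π v

/-- `σ(G)`: the number of successive linear orderings of the vertices of `G`. -/
noncomputable def sigmaG (G : SimpleGraph V) : ℕ :=
  Nat.card {π : V ≃ Fin (Fintype.card V) // IsSuccessive G π}

/-- Vertex `v` is bad in the ordering `π`: it is not first, yet appears before
all of its neighbours. -/
def IsBad (G : SimpleGraph V) (π : V ≃ Fin (Fintype.card V)) (v : V) : Prop :=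
  (π v : ℕ) ≠ 0 ∧ ∀ u : V, G.Adj u v → π v < π u

/-- Vertex `v` is good in the ordering `π`: it is first or some neighbour appears earlier. -/
def IsGood (G : SimpleGraph V) (π : V ≃ Fin (Fintype.card V)) (v : V) : Prop :=
  (π v : ℕ) = 0 ∨ ∃ u : V, G.Adj u v ∧ π u < π v

/-- For each `j`, the vertex `ρ_j` is the earliest element of `N[{ρ_j, …, ρ_k}]` under `π`. -/
def EarliestAll (G : SimpleGraph V) [DecidableRel G.Adj]
    (π : V ≃ Fin (Fintype.card V)) : List V → Prop
  | [] => True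
  | v :: l =>
      (∀ u ∈ closedNbhd G (v :: l).toFinset, u ≠ v → π v < π u) ∧ EarliestAll G π l

/-- The event `C_ρ`: the vertices of `ρ` appear in the relative order
`ρ₁ ≺ ρ₂ ≺ ⋯ ≺ ρ_k`, and each `ρ_j` is the earliest element of `N[{ρ_j, …, ρ_k}]`. -/
def CEvent (G : SimpleGraph V) [DecidableRel G.Adj]
    (π : V ≃ Fin (Fintype.card V)) (ρ : List V) : Prop :=
  ρ.Chain' (fun a b => π a < π b) ∧ EarliestAll G π ρ

/-- The weight `w(I) = (a(I)/n) · b(I)`. -/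
noncomputable def wPar (G : SimpleGraph V) [DecidableRel G.Adj] (I : Finset V) : ℚ :=
  ((aPar G I : ℚ) / (Fintype.card V : ℚ)) * bPar G I

/-- The successive ordering polynomial `P_G(x) = Σ_I w(I) x^{|I|}` over independent sets. -/
noncomputable def PG (G : SimpleGraph V) [DecidableRel G.Adj] : Polynomial ℚ :=
  ∑ I ∈ Finset.univ.filter (fun I : Finset V => IsIndep G I),
    Polynomial.C (wPar G I) * Polynomial.X ^ I.card

/-- `r(π)`: the number of bad vertices of the ordering `π`. -/
noncomputable def badCount (G : SimpleGraph V) (π : V ≃ Fin (Fintype.card V)) : ℕ :=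
  Nat.card {v : V // IsBad G π v}

/-- Closed neighbourhood inside the induced subgraph on the vertex set `W`. -/
def closW (G : SimpleGraph V) [DecidableRel G.Adj] (W I : Finset V) : Finset V :=
  closedNbhd G I ∩ W

/-- The parameter `a` computed in the induced subgraph on `W`. -/
def aW (G : SimpleGraph V) [DecidableRel G.Adj] (W I : Finset V) : ℕ :=
  W.card - (closW G W I).card

/-- The product term computed in the induced subgraph on `W`. -/
def prodTermW (G : SimpleGraph V) [DecidableRel G.Adj] (W : Finset V) : List V → ℚ
  | [] => 1
  | v :: l => (1 / ((W.card : ℚ) - (aW G W (v :: l).toFinset : ℚ))) * prodTermW G W l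

/-- The parameter `b` computed in the induced subgraph on `W`. -/
noncomputable def bW (G : SimpleGraph V) [DecidableRel G.Adj] (W I : Finset V) : ℚ :=
  (I.toList.permutations.map (prodTermW G W)).sum

/-- The weight `w` computed in the induced subgraph on `W`. -/
noncomputable def wW (G : SimpleGraph V) [DecidableRel G.Adj] (W I : Finset V) : ℚ :=
  ((aW G W I : ℚ) / (W.card : ℚ)) * bW G W I

/-- The successive ordering polynomial of the induced subgraph on `W`. -/
noncomputable def PW (G : SimpleGraph V) [DecidableRel G.Adj] (W : Finset V) : Polynomial ℚ :=
  ∑ I ∈ W.powerset.filter (fun I : Finset V => IsIndep G I),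
    Polynomial.C (wW G W I) * Polynomial.X ^ I.card

/-- The multivariate successive ordering polynomial `𝒫_G(x) = Σ_I w(I) ∏_{v ∈ I} x_v`. -/
noncomputable def mvP (G : SimpleGraph V) [DecidableRel G.Adj] : MvPolynomial V ℚ :=
  ∑ I ∈ Finset.univ.filter (fun I : Finset V => IsIndep G I),
    MvPolynomial.C (wPar G I) * ∏ v ∈ I, MvPolynomial.X v

/-- The enumerations of a finite set, as lists without repetition. -/
noncomputable def enumerations (W : Finset V) : Finset (List V) :=
  W.toList.permutations.toFinset

omit [Fintype V] in
theorem mem_enumerations {W : Finset V} {l : List V} :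
    l ∈ enumerations W ↔ l.Nodup ∧ l.toFinset = W := by
  rw [enumerations, List.mem_toFinset, List.mem_permutations]
  constructor
  · intro h
    exact ⟨h.nodup_iff.2 W.nodup_toList, by rw [List.toFinset_eq_of_perm _ _ h, toList_toFinset]⟩
  · rintro ⟨h, rfl⟩
    exact (List.toFinset_toList h).symm

omit [Fintype V] in
theorem enumerations_empty : enumerations (∅ : Finset V) = {[]} := by
  simp [enumerations]

omit [Fintype V] in
/-- Splitting an enumeration of a nonempty set into its first element and the rest. -/
theorem sum_enumerations {M : Type*} [AddCommMonoid M] {W : Finset V} (hW : W.Nonempty)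
    (f : List V → M) :
    ∑ l ∈ enumerations W, f l = ∑ x ∈ W, ∑ l ∈ enumerations (W.erase x), f (x :: l) := by
  rw [sum_sigma']
  symm
  refine sum_bij (fun p _ => p.1 :: p.2) ?_ ?_ ?_ (fun _ _ => rfl)
  · rintro ⟨x, l⟩ h
    simp only [mem_sigma, mem_enumerations] at h ⊢
    obtain ⟨hx, hl, hlW⟩ := h
    have hxl : x ∉ l := by
      rw [← List.mem_toFinset, hlW]
      exact notMem_erase x W
    exact ⟨List.nodup_cons.2 ⟨hxl, hl⟩, by rw [List.toFinset_cons, hlW, insert_erase hx]⟩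
  · rintro ⟨x, l⟩ - ⟨y, m⟩ - h
    obtain ⟨rfl, rfl⟩ := List.cons.inj h
    rfl
  · intro l hl
    rw [mem_enumerations] at hl
    obtain ⟨hl, rfl⟩ := hl
    cases l with
    | nil => simp at hW
    | cons x l =>
      obtain ⟨hx, hl⟩ := List.nodup_cons.1 hl
      refine ⟨⟨x, l⟩, ?_, rfl⟩
      simp only [mem_sigma, mem_enumerations]
      refine ⟨by simp, hl, ?_⟩
      rw [List.toFinset_cons, erase_insert (by simpa using hx)]

theorem bPar_eq_sum (G : SimpleGraph V) [DecidableRel G.Adj] (I : Finset V) :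
    bPar G I = ∑ l ∈ enumerations I, prodTerm G l := by
  rw [bPar, enumerations, List.sum_toFinset _ (List.nodup_permutations _ I.nodup_toList)]

theorem mem_closedNbhd {G : SimpleGraph V} [DecidableRel G.Adj] {I : Finset V} {x : V} :
    x ∈ closedNbhd G I ↔ x ∈ I ∨ ∃ v ∈ I, G.Adj v x := by
  simp [closedNbhd]

theorem subset_closedNbhd (G : SimpleGraph V) [DecidableRel G.Adj] (I : Finset V) :
    I ⊆ closedNbhd G I :=
  subset_union_left

theorem cast_aPar (G : SimpleGraph V) [DecidableRel G.Adj] (I : Finset V) :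
    (aPar G I : ℚ) = (Fintype.card V : ℚ) - ((closedNbhd G I).card : ℚ) := by
  rw [aPar, Nat.cast_sub (card_le_univ _)]

theorem bPar_empty (G : SimpleGraph V) [DecidableRel G.Adj] : bPar G ∅ = 1 := by
  simp [bPar_eq_sum, enumerations_empty, prodTerm]

theorem card_closedNbhd_mul_bPar (G : SimpleGraph V) [DecidableRel G.Adj] (I : Finset V) :
    ((closedNbhd G I).card : ℚ) * bPar G I = ∑ x ∈ I, bPar G (I.erase x) := by
  rcases I.eq_empty_or_nonempty with rfl | hI
  · simp [closedNbhd]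
  have hcard : ((closedNbhd G I).card : ℚ) ≠ 0 := by
    exact_mod_cast (hI.mono (subset_closedNbhd G I)).card_pos.ne'
  rw [bPar_eq_sum, sum_enumerations hI, mul_sum]
  refine sum_congr rfl fun x hx => ?_
  rw [bPar_eq_sum, mul_sum]
  refine sum_congr rfl fun l hl => ?_
  have hl' : (x :: l).toFinset = I := by
    rw [List.toFinset_cons, (mem_enumerations.1 hl).2, insert_erase hx]
  rw [prodTerm, hl', cast_aPar, sub_sub_cancel, ← mul_assoc, mul_one_div_cancel hcard, one_mul]

/-- Every vertex of `I` occurs in the list `l` before all of its neighbours. -/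
def Precedes (G : SimpleGraph V) (I : Finset V) (l : List V) : Prop :=
  ∀ v ∈ I, ∀ u, G.Adj v u → l.idxOf v < l.idxOf u

instance (G : SimpleGraph V) [DecidableRel G.Adj] (I : Finset V) : DecidablePred (Precedes G I) :=
  fun l => inferInstanceAs (Decidable (∀ v ∈ I, ∀ u, G.Adj v u → l.idxOf v < l.idxOf u))

theorem precedes_cons_of_notMem_closedNbhd {G : SimpleGraph V} [DecidableRel G.Adj]
    {I : Finset V} {x : V} (hx : x ∉ closedNbhd G I) (l : List V) :
    Precedes G I (x :: l) ↔ Precedes G I l := by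
  rw [mem_closedNbhd] at hx
  push Not at hx
  refine forall₄_congr fun v hv u huv => ?_
  have hxv : x ≠ v := fun h => hx.1 (h ▸ hv)
  have hxu : x ≠ u := fun h => hx.2 v hv (h ▸ huv)
  rw [List.idxOf_cons_ne _ hxv, List.idxOf_cons_ne _ hxu, Nat.succ_lt_succ_iff]

omit [Fintype V] in
theorem precedes_cons_of_mem {G : SimpleGraph V} {I : Finset V} (hI : IsIndep G I)
    {x : V} (hx : x ∈ I) (l : List V) :
    Precedes G I (x :: l) ↔ Precedes G (I.erase x) l := by
  constructor
  · intro h v hv u huv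
    obtain ⟨hvx, hv⟩ := mem_erase.1 hv
    have hxu : x ≠ u := fun h => hI v hv x hx (h ▸ huv)
    have := h v hv u huv
    rwa [List.idxOf_cons_ne _ hvx.symm, List.idxOf_cons_ne _ hxu, Nat.succ_lt_succ_iff] at this
  · intro h v hv u huv
    have hxu : x ≠ u := fun h => hI v hv x hx (h ▸ huv)
    by_cases hvx : x = v
    · subst hvx
      rw [List.idxOf_cons_self, List.idxOf_cons_ne _ hxu]
      exact Nat.succ_pos _
    · rw [List.idxOf_cons_ne _ hvx, List.idxOf_cons_ne _ hxu, Nat.succ_lt_succ_iff]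
      exact h v (mem_erase.2 ⟨Ne.symm hvx, hv⟩) u huv

theorem not_precedes_cons {G : SimpleGraph V} [DecidableRel G.Adj] {I : Finset V} {x : V}
    (hx : x ∈ closedNbhd G I) (hxI : x ∉ I) (l : List V) : ¬ Precedes G I (x :: l) := by
  obtain ⟨v, hv, hvx⟩ := (mem_closedNbhd.1 hx).resolve_left hxI
  intro h
  simpa using h v hv x hvx

omit [Fintype V] in
theorem IsIndep.erase {G : SimpleGraph V} {I : Finset V} (hI : IsIndep G I) (x : V) :
    IsIndep G (I.erase x) :=
  fun u hu v hv => hI u (mem_of_mem_erase hu) v (mem_of_mem_erase hv)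

theorem closedNbhd_erase_subset {G : SimpleGraph V} [DecidableRel G.Adj] {I : Finset V}
    (hI : IsIndep G I) {x : V} (hx : x ∈ I) :
    closedNbhd G (I.erase x) ⊆ (closedNbhd G I).erase x := by
  intro y hy
  rw [mem_erase, mem_closedNbhd]
  rcases mem_closedNbhd.1 hy with hy | ⟨v, hv, hvy⟩
  · exact ⟨ne_of_mem_erase hy, Or.inl (mem_of_mem_erase hy)⟩
  · have hv := mem_of_mem_erase hv
    exact ⟨fun h => hI v hv x hx (h ▸ hvy), Or.inr ⟨v, hv, hvy⟩⟩

/-- The number of enumerations of `W` in which every vertex of `I` precedes its neighbours. -/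
theorem sum_precedes (G : SimpleGraph V) [DecidableRel G.Adj] (W I : Finset V)
    (hI : IsIndep G I) (hIW : closedNbhd G I ⊆ W) :
    ∑ l ∈ enumerations W, (if Precedes G I l then 1 else 0 : ℚ)
      = (W.card.factorial : ℚ) * bPar G I := by
  induction hm : W.card generalizing W I with
  | zero =>
    obtain rfl := card_eq_zero.1 hm
    obtain rfl := subset_empty.1 ((subset_closedNbhd G I).trans hIW)
    simp [enumerations_empty, bPar_empty, Precedes]
  | succ m ih =>
    have herase : ∀ x ∈ W, (W.erase x).card = m := fun x hx => by
      rw [card_erase_of_mem hx, hm, Nat.add_sub_cancel]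
    rw [sum_enumerations (card_pos.1 (hm ▸ Nat.succ_pos m)), ← sum_sdiff hIW,
      ← sum_sdiff (subset_closedNbhd G I)]
    have houter : ∀ x ∈ W \ closedNbhd G I,
        ∑ l ∈ enumerations (W.erase x), (if Precedes G I (x :: l) then 1 else 0 : ℚ)
          = m.factorial * bPar G I := by
      intro x hx
      obtain ⟨hxW, hx⟩ := mem_sdiff.1 hx
      simp only [precedes_cons_of_notMem_closedNbhd hx]
      exact ih _ _ hI (fun y hy => mem_erase.2 ⟨fun h => hx (h ▸ hy), hIW hy⟩) (herase x hxW)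
    have hmiddle : ∀ x ∈ closedNbhd G I \ I,
        ∑ l ∈ enumerations (W.erase x), (if Precedes G I (x :: l) then 1 else 0 : ℚ) = 0 := by
      intro x hx
      obtain ⟨hx, hxI⟩ := mem_sdiff.1 hx
      simp [not_precedes_cons hx hxI]
    have hinner : ∀ x ∈ I,
        ∑ l ∈ enumerations (W.erase x), (if Precedes G I (x :: l) then 1 else 0 : ℚ)
          = m.factorial * bPar G (I.erase x) := by
      intro x hx
      simp only [precedes_cons_of_mem hI hx]
      exact ih _ _ (hI.erase x)
        ((closedNbhd_erase_subset hI hx).trans (erase_subset_erase x hIW))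
        (herase x (hIW (subset_closedNbhd G I hx)))
    rw [sum_congr rfl houter, sum_congr rfl hmiddle, sum_congr rfl hinner, sum_const_zero,
      zero_add, sum_const, nsmul_eq_mul, ← mul_sum, ← card_closedNbhd_mul_bPar,
      card_sdiff_of_subset hIW, Nat.cast_sub (card_le_card hIW), hm, Nat.factorial_succ]
    push_cast
    ring

/-- Every vertex of `I` occurs in the list `l` before all of its neighbours, but not first. -/
def AllBad (G : SimpleGraph V) (I : Finset V) (l : List V) : Prop :=
  ∀ v ∈ I, l.idxOf v ≠ 0 ∧ ∀ u, G.Adj u v → l.idxOf v < l.idxOf u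

instance (G : SimpleGraph V) [DecidableRel G.Adj] (I : Finset V) : DecidablePred (AllBad G I) :=
  fun l => inferInstanceAs
    (Decidable (∀ v ∈ I, l.idxOf v ≠ 0 ∧ ∀ u, G.Adj u v → l.idxOf v < l.idxOf u))

omit [Fintype V] in
theorem AllBad.precedes {G : SimpleGraph V} {I : Finset V} {l : List V} (h : AllBad G I l) :
    Precedes G I l :=
  fun v hv u huv => (h v hv).2 u huv.symm

theorem allBad_cons_of_notMem_closedNbhd {G : SimpleGraph V} [DecidableRel G.Adj]
    {I : Finset V} {x : V} (hx : x ∉ closedNbhd G I) (l : List V) :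
    AllBad G I (x :: l) ↔ Precedes G I l := by
  rw [← precedes_cons_of_notMem_closedNbhd hx]
  refine ⟨AllBad.precedes, fun h v hv => ⟨?_, fun u huv => h v hv u huv.symm⟩⟩
  have hxv : x ≠ v := fun h => hx (subset_closedNbhd G I (h ▸ hv))
  rw [List.idxOf_cons_ne _ hxv]
  exact Nat.succ_ne_zero _

theorem not_allBad_cons {G : SimpleGraph V} [DecidableRel G.Adj] {I : Finset V} {x : V}
    (hx : x ∈ closedNbhd G I) (l : List V) : ¬ AllBad G I (x :: l) := by
  intro h
  by_cases hxI : x ∈ I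
  · exact (h x hxI).1 List.idxOf_cons_self
  · exact not_precedes_cons hx hxI l h.precedes

omit [Fintype V] in
theorem AllBad.isIndep {G : SimpleGraph V} {I : Finset V} {l : List V} (h : AllBad G I l) :
    IsIndep G I :=
  fun u hu v hv huv => lt_asymm ((h u hu).2 v huv.symm) ((h v hv).2 u huv)

theorem sum_allBad [Nonempty V] (G : SimpleGraph V) [DecidableRel G.Adj] (I : Finset V)
    (hI : IsIndep G I) :
    ∑ l ∈ enumerations univ, (if AllBad G I l then 1 else 0 : ℚ)
      = ((Fintype.card V).factorial : ℚ) * wPar G I := by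
  obtain ⟨m, hm⟩ := Nat.exists_eq_succ_of_ne_zero (Fintype.card_ne_zero (α := V))
  rw [sum_enumerations univ_nonempty, ← sum_sdiff (subset_univ (closedNbhd G I))]
  have houter : ∀ x ∈ univ \ closedNbhd G I,
      ∑ l ∈ enumerations (univ.erase x), (if AllBad G I (x :: l) then 1 else 0 : ℚ)
        = m.factorial * bPar G I := by
    intro x hx
    have hx := (mem_sdiff.1 hx).2
    simp only [allBad_cons_of_notMem_closedNbhd hx]
    have hsub : closedNbhd G I ⊆ univ.erase x :=
      fun y hy => mem_erase.2 ⟨fun h => hx (h ▸ hy), mem_univ y⟩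
    rw [sum_precedes G _ I hI hsub,
      card_erase_of_mem (mem_univ x), card_univ, hm, Nat.succ_sub_one]
  have hinner : ∀ x ∈ closedNbhd G I,
      ∑ l ∈ enumerations (univ.erase x), (if AllBad G I (x :: l) then 1 else 0 : ℚ) = 0 := by
    intro x hx
    simp [not_allBad_cons hx]
  have hm0 : (m + 1 : ℚ) ≠ 0 := by positivity
  rw [sum_congr rfl houter, sum_congr rfl hinner, sum_const_zero, add_zero, sum_const,
    nsmul_eq_mul, card_sdiff_of_subset (subset_univ _),
    Nat.cast_sub (card_le_card (subset_univ _)), card_univ, wPar, cast_aPar, hm, Nat.factorial_succ]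
  push_cast
  field_simp

theorem idxOf_ofFn_symm (π : V ≃ Fin (Fintype.card V)) (v : V) :
    (List.ofFn π.symm).idxOf v = π v := by
  have hnodup : (List.ofFn π.symm).Nodup := List.nodup_ofFn.2 π.symm.injective
  have := hnodup.idxOf_getElem (π v) (by simp)
  simpa using this

/-- Linear orderings of the vertices correspond to enumerations of the vertex set. -/
theorem sum_equiv_eq_sum_enumerations {M : Type*} [AddCommMonoid M] (f : List V → M) :
    ∑ π : V ≃ Fin (Fintype.card V), f (List.ofFn π.symm) = ∑ l ∈ enumerations univ, f l := by
  refine sum_bij (fun π _ => List.ofFn π.symm) ?_ ?_ ?_ (fun _ _ => rfl)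
  · intro π _
    rw [mem_enumerations]
    refine ⟨List.nodup_ofFn.2 π.symm.injective, eq_univ_of_forall fun v => ?_⟩
    rw [List.mem_toFinset, List.mem_ofFn]
    exact ⟨π v, π.symm_apply_apply v⟩
  · intro π _ τ _ h
    exact Equiv.symm_bijective.injective (DFunLike.coe_injective (List.ofFn_injective h))
  · intro l hl
    obtain ⟨hl, hlV⟩ := mem_enumerations.1 hl
    have hmem : ∀ v, v ∈ l := fun v => by rw [← List.mem_toFinset, hlV]; exact mem_univ v
    have hlen : Fintype.card V = l.length := by
      rw [← List.toFinset_card_of_nodup hl, hlV, card_univ]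
    refine ⟨((finCongr hlen).trans (hl.getEquivOfForallMemList l hmem)).symm, mem_univ _, ?_⟩
    apply List.ext_getElem
    · simp [hlen]
    · intro i h₁ h₂
      simp

/-- `σ(G) = n! · P_G(−1)`; equivalently `P_G(−1)` is the probability
that a uniformly random linear ordering is successive. -/
theorem sigma_eq_eval_neg_one (G : SimpleGraph V) [DecidableRel G.Adj]
    (hG : G.Connected) :
    (sigmaG G : ℚ) = (Nat.factorial (Fintype.card V) : ℚ) * (PG G).eval (-1) ∧
      (PG G).eval (-1) = (sigmaG G : ℚ) / (Nat.factorial (Fintype.card V) : ℚ) := by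
  classical
  have : Nonempty V := hG.nonempty
  have hfac : ((Fintype.card V).factorial : ℚ) ≠ 0 := by
    exact_mod_cast Nat.factorial_ne_zero _
  suffices h : (sigmaG G : ℚ) = (Nat.factorial (Fintype.card V) : ℚ) * (PG G).eval (-1) from
    ⟨h, by rw [h, mul_div_cancel_left₀ _ hfac]⟩
  have hsubset : ∀ (π : V ≃ Fin (Fintype.card V)) (I : Finset V),
      I ∈ (univ.filter (IsBad G π)).powerset ↔ AllBad G I (List.ofFn π.symm) := by
    intro π I
    simp only [mem_powerset, subset_iff, mem_filter, mem_univ, true_and, AllBad,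
      idxOf_ofFn_symm, IsBad, Fin.lt_def]
  have hsucc : ∀ π : V ≃ Fin (Fintype.card V),
      (if IsSuccessive G π then 1 else 0 : ℚ)
        = ∑ I : Finset V, if AllBad G I (List.ofFn π.symm) then (-1) ^ I.card else 0 := by
    intro π
    have hiff : IsSuccessive G π ↔ univ.filter (IsBad G π) = ∅ := by
      rw [filter_eq_empty_iff]
      simp only [mem_univ, true_imp_iff, IsSuccessive, IsBad, not_and, not_forall, not_lt]
      refine forall₂_congr fun v _ => exists_congr fun u => ?_
      rw [exists_prop]
      exact and_congr_right fun huv => ⟨le_of_lt, fun h => h.lt_of_ne fun h =>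
        huv.ne (π.injective h)⟩
    simp only [hiff, ← hsubset]
    rw [← sum_filter, filter_mem_eq_inter, univ_inter]
    exact_mod_cast (sum_powerset_neg_one_pow_card (x := univ.filter (IsBad G π))).symm
  calc (sigmaG G : ℚ)
      = ∑ π : V ≃ Fin (Fintype.card V), (if IsSuccessive G π then 1 else 0 : ℚ) := by
        rw [sigmaG, Nat.card_eq_fintype_card, Fintype.card_subtype, sum_boole]
    _ = ∑ I : Finset V, ∑ π : V ≃ Fin (Fintype.card V),
          (if AllBad G I (List.ofFn π.symm) then (-1) ^ I.card else 0 : ℚ) := by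
        rw [sum_comm]
        exact sum_congr rfl fun π _ => hsucc π
    _ = ∑ I : Finset V, if IsIndep G I then
          (Fintype.card V).factorial * (wPar G I * (-1) ^ I.card) else 0 := by
        refine sum_congr rfl fun I _ => ?_
        rw [sum_equiv_eq_sum_enumerations
          (fun l => (if AllBad G I l then (-1) ^ I.card else 0 : ℚ))]
        split_ifs with hI
        · rw [← mul_assoc, ← sum_allBad G I hI, sum_mul]
          simp only [ite_mul, one_mul, zero_mul]
        · exact sum_eq_zero fun l _ => if_neg fun h => hI h.isIndep
    _ = (Fintype.card V).factorial * (PG G).eval (-1) := by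
        rw [← sum_filter, PG, eval_finsetSum, mul_sum]
        simp
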